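/- Let n be a squarefree positive integer and let r be a divisor of n. Then T_r(n) := Σ_{α ∈ (ℤ/nℤ)ˣ} (a_α / r_odd) · |X_n^α|² equals −(4/5)·|Δ(ℤ/nℤ)|·F₁(n/r)·F₂(r) if r is even, and equals |Δ(ℤ/nℤ)|·F₁(n/r)·F₂(r) if r is odd. -/

import Mathlib

open Matrix

noncomputable section

/-- For a commutative ring `R` (here `ZMod n`), `Δ(R)` is the set of pairs of matrices
`(M₁, M₂) ∈ GL₂(R) × GL₂(R)` with `det M₁ = det M₂`. -/
def DeltaPairs (n : ℕ) : Set (GL (Fin 2) (ZMod n) × GL (Fin 2) (ZMod n)) :=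
  {P | ((P.1 : Matrix (Fin 2) (Fin 2) (ZMod n))).det =
       ((P.2 : Matrix (Fin 2) (Fin 2) (ZMod n))).det}

/-- For a positive integer `n` and a unit `α ∈ (ℤ/nℤ)ˣ`, `Xset n α` is the set of
matrices `M ∈ GL₂(ℤ/nℤ)` with `det (I − M) = 0` and `det M = α`. -/
def Xset (n : ℕ) (α : (ZMod n)ˣ) : Set (GL (Fin 2) (ZMod n)) :=
  {M | ((1 : Matrix (Fin 2) (Fin 2) (ZMod n)) -
          (M : Matrix (Fin 2) (Fin 2) (ZMod n))).det = 0 ∧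
       (M : Matrix (Fin 2) (Fin 2) (ZMod n)).det = (α : ZMod n)}

/-- `F₁(n) = ∏_{primes ℓ ∣ n} (ℓ+2)(ℓ²−ℓ−1)/((ℓ−1)³(ℓ+1)²)`, with `F₁(1) = 1`. -/
def F1 (n : ℕ) : ℚ :=
  ∏ ℓ ∈ n.primeFactors,
    (((ℓ : ℚ) + 2) * ((ℓ : ℚ) ^ 2 - ℓ - 1)) / (((ℓ : ℚ) - 1) ^ 3 * ((ℓ : ℚ) + 1) ^ 2)

/-- `F₂(n) = ∏_{primes ℓ ∣ n} (−(2ℓ+1))/((ℓ−1)³(ℓ+1)²)`, with `F₂(1) = 1`. -/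
def F2 (n : ℕ) : ℚ :=
  ∏ ℓ ∈ n.primeFactors,
    (-(2 * (ℓ : ℚ) + 1)) / (((ℓ : ℚ) - 1) ^ 3 * ((ℓ : ℚ) + 1) ^ 2)

/-- `T_r(n) = ∑_{α ∈ (ℤ/nℤ)ˣ} (a_α / r_odd) ⬝ |X_n^α|²`, where `a : (ℤ/nℤ)ˣ → ℤ`
assigns to each `α` an integer lift `a_α`, `r_odd` is the odd part of `r`, and
`(⬝ / ⬝)` is the Jacobi symbol. -/
def Tsum (n : ℕ) [NeZero n] (r : ℕ) (a : (ZMod n)ˣ → ℤ) : ℚ :=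
  ∑ α : (ZMod n)ˣ,
    (jacobiSym (a α) (ordCompl[2] r) : ℚ) * (Nat.card (Xset n α) : ℚ) ^ 2

/-- The number of solutions of `x * (β - x) = y * z` in a commutative ring. -/
def cardShiftedFiber (R : Type*) [CommRing R] (β : R) : ℕ :=
  Nat.card {q : R × R × R // q.1 * (β - q.1) = q.2.1 * q.2.2}

/-- The twisted second moment of the numbers of matrices with eigenvalue `1`
and given determinant. -/
def twistedMoment (R : Type*) [CommRing R] [Fintype Rˣ] (ψ : Rˣ → ℚ) : ℚ :=
  ∑ α : Rˣ, ψ α * (cardShiftedFiber R ((α : R) - 1) : ℚ) ^ 2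

/-- The number of pairs of invertible matrices with equal determinants. -/
def cardDelta (R : Type*) [CommRing R] : ℕ :=
  Nat.card {P : Matrix (Fin 2) (Fin 2) R × Matrix (Fin 2) (Fin 2) R //
    IsUnit P.1.det ∧ P.1.det = P.2.det}

lemma card_Xset_eq (n : ℕ) (α : (ZMod n)ˣ) :
    Nat.card (Xset n α) = cardShiftedFiber (ZMod n) ((α : ZMod n) - 1) := by
  refine Nat.card_congr (Equiv.ofBijective
    (fun M => ⟨(M.1.1 0 0 - 1, M.1.1 0 1, M.1.1 1 0), ?_⟩) ⟨?_, ?_⟩)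
  · obtain ⟨M, h1, h2⟩ := M
    simp only [Matrix.det_fin_two, Matrix.sub_apply, Matrix.one_apply] at h1 h2
    simp at h1
    simp only
    linear_combination (M.1 0 0 - 1) * (h1 - h2) + h1
  · rintro ⟨M, h1, h2⟩ ⟨N, h3, h4⟩ h
    simp only [Matrix.det_fin_two, Matrix.sub_apply, Matrix.one_apply] at h1 h2 h3 h4
    simp at h1 h3
    simp only [Subtype.mk.injEq, Prod.mk.injEq, sub_left_inj] at h
    obtain ⟨h5, h6, h7⟩ := h
    refine Subtype.ext (Units.ext (Matrix.ext fun i j => ?_))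
    fin_cases i <;> fin_cases j
    · exact h5
    · exact h6
    · exact h7
    · simp only [Fin.mk_one]
      linear_combination h2 - h4 - h1 + h3 - h5
  · rintro ⟨⟨x, y, z⟩, h⟩
    simp only at h
    have hdet : (!![x + 1, y; z, (α : ZMod n) - x] : Matrix (Fin 2) (Fin 2) (ZMod n)).det
        = α := by
      rw [Matrix.det_fin_two_of]
      linear_combination h
    refine ⟨⟨Matrix.GeneralLinearGroup.mk'' !![x + 1, y; z, (α : ZMod n) - x]
      (by rw [hdet]; exact α.isUnit), ?_, hdet⟩, ?_⟩
    · change ((1 : Matrix (Fin 2) (Fin 2) (ZMod n)) - !![x + 1, y; z, (α : ZMod n) - x]).det = 0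
      simp only [Matrix.det_fin_two, Matrix.sub_apply, Matrix.one_apply]
      simp
      linear_combination h
    · refine Subtype.ext ?_
      change (x + 1 - 1, y, z) = (x, y, z)
      simp

lemma cardShiftedFiber_of_equiv_prod {R S T : Type*} [CommRing R] [CommRing S] [CommRing T]
    (e : R ≃+* S × T) (β : R) :
    cardShiftedFiber R β = cardShiftedFiber S (e β).1 * cardShiftedFiber T (e β).2 := by
  rw [cardShiftedFiber, cardShiftedFiber, cardShiftedFiber, ← Nat.card_prod]
  refine Nat.card_congr (Equiv.ofBijective (fun q =>
    (⟨((e q.1.1).1, (e q.1.2.1).1, (e q.1.2.2).1), ?_⟩,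
      ⟨((e q.1.1).2, (e q.1.2.1).2, (e q.1.2.2).2), ?_⟩)) ⟨?_, ?_⟩)
  · simpa using congrArg (fun x => (e x).1) q.2
  · simpa using congrArg (fun x => (e x).2) q.2
  · rintro ⟨⟨x, y, z⟩, h⟩ ⟨⟨x', y', z'⟩, h'⟩ hq
    simp only [Prod.mk.injEq, Subtype.mk.injEq] at hq ⊢
    exact ⟨e.injective (Prod.ext hq.1.1 hq.2.1), e.injective (Prod.ext hq.1.2.1 hq.2.2.1),
      e.injective (Prod.ext hq.1.2.2 hq.2.2.2)⟩
  · rintro ⟨⟨⟨x, y, z⟩, h⟩, ⟨⟨x', y', z'⟩, h'⟩⟩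
    refine ⟨⟨(e.symm (x, x'), e.symm (y, y'), e.symm (z, z')), ?_⟩, by simp⟩
    apply e.injective
    simp only at h h'
    simp [Prod.ext_iff, h, h']

lemma twistedMoment_of_equiv_prod {R S T : Type*} [CommRing R] [CommRing S] [CommRing T]
    [Fintype Rˣ] [Fintype Sˣ] [Fintype Tˣ] (e : R ≃+* S × T)
    (ψ : Rˣ → ℚ) (ψS : Sˣ → ℚ) (ψT : Tˣ → ℚ)
    (h : ∀ (α : Rˣ) (β : Sˣ) (γ : Tˣ), e α = (↑β, ↑γ) → ψ α = ψS β * ψT γ) :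
    twistedMoment R ψ = twistedMoment S ψS * twistedMoment T ψT := by
  rw [twistedMoment, twistedMoment, twistedMoment, Fintype.sum_mul_sum,
    ← Fintype.sum_prod_type']
  refine Fintype.sum_equiv
    ((Units.mapEquiv e.toMulEquiv).trans MulEquiv.prodUnits).toEquiv _ _ fun α => ?_
  set p := ((Units.mapEquiv e.toMulEquiv).trans MulEquiv.prodUnits).toEquiv α with hp
  have hα : e α = (↑p.1, ↑p.2) := rfl
  rw [h α p.1 p.2 hα, cardShiftedFiber_of_equiv_prod e, map_sub, map_one, hα]
  push_cast
  simp only [Prod.fst_sub, Prod.snd_sub, Prod.fst_one, Prod.snd_one]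
  ring

lemma cardDelta_of_equiv_prod {R S T : Type*} [CommRing R] [CommRing S] [CommRing T]
    (e : R ≃+* S × T) : cardDelta R = cardDelta S * cardDelta T := by
  rw [cardDelta, cardDelta, cardDelta, ← Nat.card_prod]
  let f : R →+* S := (RingHom.fst S T).comp e.toRingHom
  let g : R →+* T := (RingHom.snd S T).comp e.toRingHom
  have hfg : ∀ x y, f x = f y → g x = g y → x = y := fun x y hx hy =>
    e.injective (Prod.ext hx hy)
  have hf : ∀ s t, f (e.symm (s, t)) = s := fun s t =>
    congrArg Prod.fst (e.apply_symm_apply (s, t))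
  have hg : ∀ s t, g (e.symm (s, t)) = t := fun s t =>
    congrArg Prod.snd (e.apply_symm_apply (s, t))
  have hdf : ∀ M : Matrix (Fin 2) (Fin 2) R, (M.map f).det = f M.det := fun M =>
    (f.map_det M).symm
  have hdg : ∀ M : Matrix (Fin 2) (Fin 2) R, (M.map g).det = g M.det := fun M =>
    (g.map_det M).symm
  refine Nat.card_congr (Equiv.ofBijective (fun P =>
    (⟨(P.1.1.map f, P.1.2.map f), ?_⟩, ⟨(P.1.1.map g, P.1.2.map g), ?_⟩)) ⟨?_, ?_⟩)
  · exact ⟨by simpa only [hdf] using P.2.1.map f, by simp only [hdf, P.2.2]⟩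
  · exact ⟨by simpa only [hdg] using P.2.1.map g, by simp only [hdg, P.2.2]⟩
  · rintro ⟨⟨M, N⟩, h⟩ ⟨⟨M', N'⟩, h'⟩ hq
    simp only [Prod.mk.injEq, Subtype.mk.injEq] at hq ⊢
    obtain ⟨⟨h1, h2⟩, h3, h4⟩ := hq
    exact ⟨Matrix.ext fun i j => hfg _ _ (congrFun₂ h1 i j) (congrFun₂ h3 i j),
      Matrix.ext fun i j => hfg _ _ (congrFun₂ h2 i j) (congrFun₂ h4 i j)⟩
  · rintro ⟨⟨⟨M, N⟩, hu, h⟩, ⟨⟨M', N'⟩, hu', h'⟩⟩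
    simp only at h h' hu hu'
    let glue (A : Matrix (Fin 2) (Fin 2) S) (B : Matrix (Fin 2) (Fin 2) T) :
      Matrix (Fin 2) (Fin 2) R := Matrix.of fun i j => e.symm (A i j, B i j)
    have hgf : ∀ A B, (glue A B).map f = A := fun A B => Matrix.ext fun i j => hf _ _
    have hgg : ∀ A B, (glue A B).map g = B := fun A B => Matrix.ext fun i j => hg _ _
    refine ⟨⟨(glue M M', glue N N'), ?_, ?_⟩, ?_⟩
    · have : IsUnit (e (glue M M').det) := by
        rw [Prod.isUnit_iff]
        refine ⟨?_, ?_⟩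
        · change IsUnit (f _)
          rwa [← hdf, hgf]
        · change IsUnit (g _)
          rwa [← hdg, hgg]
      simpa using this
    · apply hfg
      · simp only [← hdf, hgf, h]
      · simp only [← hdg, hgg, h']
    · simp only [hgf, hgg]

lemma card_DeltaPairs_eq (n : ℕ) : Nat.card (DeltaPairs n) = cardDelta (ZMod n) := by
  refine Nat.card_congr (Equiv.ofBijective (fun P => ⟨(P.1.1.1, P.1.2.1), ?_⟩) ⟨?_, ?_⟩)
  · exact ⟨(Matrix.isUnit_iff_isUnit_det _).1 P.1.1.isUnit, P.2⟩
  · rintro ⟨⟨M, N⟩, h⟩ ⟨⟨M', N'⟩, h'⟩ hq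
    simp only [Prod.mk.injEq, Subtype.mk.injEq] at hq ⊢
    exact ⟨Units.ext hq.1, Units.ext hq.2⟩
  · rintro ⟨⟨M, N⟩, hu, h⟩
    exact ⟨⟨(Matrix.GeneralLinearGroup.mk'' M hu,
      Matrix.GeneralLinearGroup.mk'' N (by simpa only [← h] using hu)), h⟩, rfl⟩

lemma card_DeltaPairs_mul_card_units (n : ℕ) :
    Nat.card (DeltaPairs n) * Nat.card (ZMod n)ˣ = Nat.card (GL (Fin 2) (ZMod n)) ^ 2 := by
  let d : GL (Fin 2) (ZMod n) →* (ZMod n)ˣ := Matrix.GeneralLinearGroup.det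
  have hd : Function.Surjective d := fun u =>
    ⟨Matrix.GeneralLinearGroup.mk'' !![(u : ZMod n), 0; 0, 1] (by simp),
      Units.ext (by change (!![(u : ZMod n), 0; 0, 1]).det = u; simp)⟩
  have hker : Nat.card d.ker * Nat.card (ZMod n)ˣ = Nat.card (GL (Fin 2) (ZMod n)) := by
    rw [← Subgroup.card_mul_index d.ker, Subgroup.index_ker, MonoidHom.range_eq_top.2 hd,
      Subgroup.card_top]
  have hΔ : Nat.card (DeltaPairs n) = Nat.card (GL (Fin 2) (ZMod n)) * Nat.card d.ker := by
    rw [← Nat.card_prod]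
    refine Nat.card_congr
      { toFun := fun P => (P.1.1, ⟨P.1.1⁻¹ * P.1.2, ?_⟩)
        invFun := fun Q => ⟨(Q.1, Q.1 * Q.2.1), ?_⟩
        left_inv := fun P => by simp
        right_inv := fun Q => by simp }
    · have : d P.1.1 = d P.1.2 := Units.ext P.2
      rw [MonoidHom.mem_ker, map_mul, map_inv, this, inv_mul_cancel]
    · have : d (Q.1 * Q.2.1) = d Q.1 := by
        rw [map_mul, MonoidHom.mem_ker.1 Q.2.2, mul_one]
      exact (congrArg Units.val this).symm
  rw [hΔ, mul_assoc, hker, sq]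

lemma card_DeltaPairs_prime (p : ℕ) [hp : Fact p.Prime] :
    (Nat.card (DeltaPairs p) : ℚ) = (p : ℚ) ^ 2 * ((p : ℚ) - 1) ^ 3 * ((p : ℚ) + 1) ^ 2 := by
  have h := card_DeltaPairs_mul_card_units p
  have h1 : (1 : ℚ) < p := by exact_mod_cast hp.out.one_lt
  have hu : (Nat.card (ZMod p)ˣ : ℚ) = p - 1 := by
    rw [Nat.card_eq_fintype_card, ZMod.card_units, Nat.cast_sub hp.out.one_le, Nat.cast_one]
  have hG : (Nat.card (GL (Fin 2) (ZMod p)) : ℚ) = ((p : ℚ) ^ 2 - 1) * ((p : ℚ) ^ 2 - p) := by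
    rw [Matrix.card_GL_field, Fin.prod_univ_two, ZMod.card, Nat.cast_mul, Nat.cast_sub,
      Nat.cast_sub]
    · simp
    · exact Nat.pow_le_pow_right hp.out.pos (by simp)
    · exact Nat.pow_le_pow_right hp.out.pos (by simp)
  have h' : (Nat.card (DeltaPairs p) : ℚ) * Nat.card (ZMod p)ˣ
      = Nat.card (GL (Fin 2) (ZMod p)) ^ 2 := by exact_mod_cast h
  rw [hu, hG] at h'
  have hne : (p : ℚ) - 1 ≠ 0 := by linarith
  apply mul_right_cancel₀ hne
  rw [h']
  ring

lemma card_mul_eq_of_ne_zero {K : Type*} [Field K] [Fintype K] {t : K} (ht : t ≠ 0) :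
    Nat.card {q : K × K // t = q.1 * q.2} = Fintype.card K - 1 := by
  classical
  rw [← Fintype.card_units, ← Nat.card_eq_fintype_card]
  refine (Nat.card_congr (Equiv.ofBijective
    (fun u : Kˣ => ⟨((u : K), (↑u⁻¹ : K) * t), by simp⟩) ⟨?_, ?_⟩)).symm
  · intro u v h
    simp only [Subtype.mk.injEq, Prod.mk.injEq] at h
    exact Units.ext h.1
  · rintro ⟨⟨y, z⟩, h⟩
    simp only at h
    have hy : y ≠ 0 := by rintro rfl; simp_all
    refine ⟨Units.mk0 y hy, ?_⟩
    simp [h, hy]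

lemma card_mul_eq_zero {K : Type*} [Field K] [Fintype K] :
    Nat.card {q : K × K // (0 : K) = q.1 * q.2} = 2 * Fintype.card K - 1 := by
  classical
  rw [Nat.card_eq_fintype_card, Fintype.card_subtype]
  have : (Finset.univ.filter fun q : K × K => (0 : K) = q.1 * q.2)
      = ({0} : Finset K) ×ˢ Finset.univ ∪ Finset.univ ×ˢ {0} := by
    ext ⟨x, y⟩
    simp [eq_comm (a := (0 : K))]
  rw [this, Finset.card_union, Finset.card_product, Finset.card_product,
    Finset.product_inter_product]
  simp
  omega

lemma cardShiftedFiber_field {K : Type*} [Field K] [Fintype K] [DecidableEq K] (β : K) :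
    (cardShiftedFiber K β : ℚ) =
      (Fintype.card K : ℚ) ^ 2 + if β = 0 then 0 else (Fintype.card K : ℚ) := by
  have hq : 1 ≤ Fintype.card K := Fintype.card_pos
  have hfib : ∀ x : K, (Nat.card {q : K × K // x * (β - x) = q.1 * q.2} : ℚ)
      = (Fintype.card K - 1 : ℚ) + if x ∈ ({0, β} : Finset K) then (Fintype.card K : ℚ) else 0 := by
    intro x
    by_cases hx : x * (β - x) = 0
    · rw [hx, card_mul_eq_zero, if_pos, Nat.cast_sub (by omega)]
      · push_cast
        ring
      · simpa [sub_eq_zero, eq_comm] using hx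
    · rw [card_mul_eq_of_ne_zero hx, if_neg, Nat.cast_sub hq]
      · simp
      · simpa [sub_eq_zero, eq_comm] using hx
  have hsum : cardShiftedFiber K β
      = ∑ x : K, Nat.card {q : K × K // x * (β - x) = q.1 * q.2} := by
    rw [cardShiftedFiber, ← Nat.card_sigma]
    exact Nat.card_congr
      { toFun := fun q => ⟨q.1.1, q.1.2, q.2⟩
        invFun := fun s => ⟨(s.1, s.2.1), s.2.2⟩
        left_inv := fun _ => rfl
        right_inv := fun _ => rfl }
  rw [hsum, Nat.cast_sum, Finset.sum_congr rfl fun x _ => hfib x, Finset.sum_add_distrib,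
    Finset.sum_ite_mem, Finset.univ_inter, Finset.sum_const, Finset.sum_const]
  by_cases hβ : β = 0
  · simp [hβ]
    ring
  · rw [Finset.card_pair (Ne.symm hβ)]
    simp [hβ]
    ring

lemma twistedMoment_field {K : Type*} [Field K] [Fintype K] [Fintype Kˣ] (ψ : Kˣ → ℚ)
    (hψ : ψ 1 = 1) :
    twistedMoment K ψ = ((Fintype.card K : ℚ) ^ 2 + Fintype.card K) ^ 2 * ∑ α, ψ α
      - (Fintype.card K : ℚ) ^ 2 * (2 * Fintype.card K + 1) := by
  classical
  have : ∀ α : Kˣ, ψ α * (cardShiftedFiber K ((α : K) - 1) : ℚ) ^ 2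
      = ((Fintype.card K : ℚ) ^ 2 + Fintype.card K) ^ 2 * ψ α
        - if α = 1 then (Fintype.card K : ℚ) ^ 2 * (2 * Fintype.card K + 1) else 0 := by
    intro α
    rw [cardShiftedFiber_field]
    by_cases h : α = 1
    · simp only [h, Units.val_one, sub_self, if_true, hψ]
      ring
    · have : (α : K) - 1 ≠ 0 := by
        rwa [sub_ne_zero, ne_eq, Units.val_eq_one]
      simp only [h, this, if_false]
      ring
  rw [twistedMoment, Finset.sum_congr rfl fun α _ => this α, Finset.sum_sub_distrib,
    ← Finset.mul_sum, Finset.sum_ite_eq' Finset.univ]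
  simp

lemma sum_units_jacobiSym_eq_zero (p : ℕ) [hp : Fact p.Prime] (hp2 : p ≠ 2) :
    ∑ α : (ZMod p)ˣ, (jacobiSym ((α : ZMod p).val) p : ℚ) = 0 := by
  have h : ∀ α : (ZMod p)ˣ, jacobiSym ((α : ZMod p).val) p = quadraticChar (ZMod p) α := by
    intro α
    rw [← jacobiSym.legendreSym.to_jacobiSym, legendreSym]
    simp
  have h0 := quadraticChar_sum_zero (F := ZMod p) (by rwa [ZMod.ringChar_zmod_n])
  rw [← Finset.sum_subset (Finset.subset_univ (Finset.univ.filter fun a : ZMod p => a ≠ 0))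
    (by intro x _ hx; simp at hx; simp [hx])] at h0
  have h1 : ∑ α : (ZMod p)ˣ, quadraticChar (ZMod p) α = 0 := by
    rw [← h0]
    refine Finset.sum_bij (fun u _ => (u : ZMod p)) (by simp) (by simp [Units.val_inj]) ?_ (by simp)
    intro b hb
    simp only [Finset.mem_filter, Finset.mem_univ, true_and] at hb
    exact ⟨Units.mk0 b hb, by simp, rfl⟩
  simp only [h]
  exact_mod_cast h1

lemma F1_mul {a b : ℕ} (h : a.Coprime b) : F1 (a * b) = F1 a * F1 b := by
  rw [F1, h.primeFactors_mul, Finset.prod_union h.disjoint_primeFactors, F1, F1]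

lemma F2_mul {a b : ℕ} (h : a.Coprime b) : F2 (a * b) = F2 a * F2 b := by
  rw [F2, h.primeFactors_mul, Finset.prod_union h.disjoint_primeFactors, F2, F2]

lemma jacobiSym_congr_of_dvd {n b : ℕ} (hb : b ∣ n) {x y : ℤ} (h : (x : ZMod n) = y) :
    jacobiSym x b = jacobiSym y b := by
  refine jacobiSym.mod_left' ?_
  exact ((ZMod.intCast_eq_intCast_iff _ _ _).1 h).of_dvd (by exact_mod_cast hb)

/-- The sum `T_r(n)` computed with the least non-negative lifts. -/
def valTsum (n : ℕ) [NeZero n] (r : ℕ) : ℚ :=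
  twistedMoment (ZMod n) fun α => (jacobiSym ((α : ZMod n).val) (ordCompl[2] r) : ℚ)

lemma Tsum_eq_valTsum (n : ℕ) [NeZero n] {r : ℕ} (hr : r ∣ n) (a : (ZMod n)ˣ → ℤ)
    (ha : ∀ α : (ZMod n)ˣ, ((a α : ZMod n)) = (α : ZMod n)) : Tsum n r a = valTsum n r := by
  refine Finset.sum_congr rfl fun α _ => ?_
  rw [card_Xset_eq, jacobiSym_congr_of_dvd ((Nat.ordCompl_dvd r 2).trans hr)
    (y := ((α : ZMod n).val : ℤ)) (by simp [ha])]

lemma valTsum_mul {m n : ℕ} [NeZero m] [NeZero n] [NeZero (m * n)] (h : m.Coprime n)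
    {r s : ℕ} (hr : r ∣ m) (hs : s ∣ n) :
    valTsum (m * n) (r * s) = valTsum m r * valTsum n s := by
  refine twistedMoment_of_equiv_prod (ZMod.chineseRemainder h) _ _ _ fun α β γ he => ?_
  have hne : ∀ {k l : ℕ} [NeZero l], k ∣ l → ordCompl[2] k ≠ 0 := fun {k l} _ hk =>
    (Nat.ordCompl_pos 2 (ne_zero_of_dvd_ne_zero (NeZero.ne l) hk)).ne'
  have hv : ZMod.chineseRemainder h (((α : ZMod (m * n)).val : ℕ) : ZMod (m * n))
      = (↑β, ↑γ) := by rw [ZMod.natCast_zmod_val, he]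
  rw [map_natCast, Prod.ext_iff] at hv
  rw [Nat.ordCompl_mul, jacobiSym.mul_right' _ (hne hr) (hne hs), Int.cast_mul,
    jacobiSym_congr_of_dvd ((Nat.ordCompl_dvd r 2).trans hr) (y := ((β : ZMod m).val : ℤ)),
    jacobiSym_congr_of_dvd ((Nat.ordCompl_dvd s 2).trans hs) (y := ((γ : ZMod n).val : ℤ))]
  · simpa using hv.2
  · simpa using hv.1

/-- The correction factor `-4/5` at the prime `2`. -/
def evenFactor (r : ℕ) : ℚ := if Even r then -(4 / 5) else 1

lemma evenFactor_mul {r s : ℕ} (h : r.Coprime s) :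
    evenFactor (r * s) = evenFactor r * evenFactor s := by
  have : ¬ (Even r ∧ Even s) := fun ⟨hr, hs⟩ =>
    Nat.not_coprime_of_dvd_of_dvd one_lt_two hr.two_dvd hs.two_dvd h
  simp only [evenFactor, Nat.even_mul]
  by_cases hr : Even r
  · have hs : ¬ Even s := fun hs => this ⟨hr, hs⟩
    simp [hr, hs]
  · simp [hr]

lemma valTsum_prime_one (p : ℕ) [hp : Fact p.Prime] :
    valTsum p 1 = cardDelta (ZMod p) * F1 p := by
  have h1 : (1 : ℚ) < p := by exact_mod_cast hp.out.one_lt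
  have h2 : (p : ℚ) - 1 ≠ 0 := by linarith
  have h3 : (p : ℚ) + 1 ≠ 0 := by linarith
  rw [valTsum, twistedMoment_field _ (by simp), ← card_DeltaPairs_eq, card_DeltaPairs_prime, F1,
    hp.out.primeFactors, Finset.prod_singleton]
  simp [Nat.totient_prime hp.out, Nat.cast_sub hp.out.one_le]
  field_simp
  ring

lemma valTsum_prime_self (p : ℕ) [hp : Fact p.Prime] :
    valTsum p p = evenFactor p * cardDelta (ZMod p) * F2 p := by
  have h1 : (1 : ℚ) < p := by exact_mod_cast hp.out.one_lt
  have h2 : (p : ℚ) - 1 ≠ 0 := by linarith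
  have h3 : (p : ℚ) + 1 ≠ 0 := by linarith
  rw [valTsum, twistedMoment_field, ← card_DeltaPairs_eq, card_DeltaPairs_prime, F2,
    hp.out.primeFactors, Finset.prod_singleton]
  · rcases eq_or_ne p 2 with rfl | hp2
    · norm_num [evenFactor, ZMod.card_units]
    · have hodd : ¬ Even p := Nat.not_even_iff_odd.2 (hp.out.odd_of_ne_two hp2)
      have hc : ordCompl[2] p = p := by
        rw [Nat.factorization_eq_zero_of_not_dvd fun h => hodd (even_iff_two_dvd.2 h), pow_zero,
          Nat.div_one]
      rw [hc, sum_units_jacobiSym_eq_zero p hp2, evenFactor, if_neg hodd, ZMod.card]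
      field_simp
      ring
  · have : (1 : ZMod p).val = 1 := ZMod.val_one p
    simp [this]

lemma valTsum_eq (n : ℕ) [hn : NeZero n] (hsf : Squarefree n) {r : ℕ} (hr : r ∣ n) :
    valTsum n r = evenFactor r * cardDelta (ZMod n) * F1 (n / r) * F2 r := by
  induction n using induction_on_primes generalizing hn r with
  | zero => exact absurd rfl hn.out
  | one =>
    obtain rfl := Nat.dvd_one.1 hr
    have hS : cardShiftedFiber (ZMod 1) 0 = 1 := by
      rw [cardShiftedFiber, Nat.card_eq_one_iff_unique]
      exact ⟨inferInstance, ⟨⟨0, by simp⟩⟩⟩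
    have hD : cardDelta (ZMod 1) = 1 := by
      rw [cardDelta, Nat.card_eq_one_iff_unique]
      exact ⟨inferInstance, ⟨⟨0, isUnit_of_subsingleton _, rfl⟩⟩⟩
    rw [hD]
    simp [valTsum, twistedMoment, evenFactor, F1, F2, hS, Subsingleton.elim _ (0 : ZMod 1)]
  | prime_mul p m hp ih =>
    have := Fact.mk hp
    obtain ⟨hcop, -, hm⟩ := Nat.squarefree_mul_iff.1 hsf
    have : NeZero m := ⟨hm.ne_zero⟩
    obtain ⟨s, t, hs, ht, rfl⟩ := (Nat.dvd_mul).1 hr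
    have hst : s.Coprime t := hcop.of_dvd hs ht
    have hdiv : p * m / (s * t) = p / s * (m / t) := (Nat.div_mul_div_comm hs ht).symm
    have hp' : valTsum p s = evenFactor s * cardDelta (ZMod p) * F1 (p / s) * F2 s := by
      rcases (Nat.dvd_prime hp).1 hs with rfl | rfl
      · rw [valTsum_prime_one]
        simp [evenFactor, F2]
      · rw [valTsum_prime_self, Nat.div_self hp.pos]
        simp [F1]
    rw [valTsum_mul hcop hs ht, hp', ih hm ht, hdiv, evenFactor_mul hst, F2_mul hst,
      F1_mul (hcop.of_dvd (Nat.div_dvd_of_dvd hs) (Nat.div_dvd_of_dvd ht)),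
      cardDelta_of_equiv_prod (ZMod.chineseRemainder hcop)]
    push_cast
    ring

/-- Let `n` be a squarefree positive integer and `r ∣ n`. Then
`T_r(n) = −(4/5)⬝|Δ(ℤ/nℤ)|⬝F₁(n/r)⬝F₂(r)` if `r` is even, and
`T_r(n) = |Δ(ℤ/nℤ)|⬝F₁(n/r)⬝F₂(r)` if `r` is odd. -/
theorem Tsum_eq (n : ℕ) [NeZero n] (hsf : Squarefree n) (r : ℕ) (hr : r ∣ n)
    (a : (ZMod n)ˣ → ℤ) (ha : ∀ α : (ZMod n)ˣ, ((a α : ZMod n)) = (α : ZMod n)) :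
    (Even r →
      Tsum n r a = -(4 / 5) * (Nat.card (DeltaPairs n) : ℚ) * F1 (n / r) * F2 r) ∧
    (Odd r →
      Tsum n r a = (Nat.card (DeltaPairs n) : ℚ) * F1 (n / r) * F2 r) := by
  rw [Tsum_eq_valTsum n hr a ha, valTsum_eq n hsf hr, card_DeltaPairs_eq]
  refine ⟨fun h => ?_, fun h => ?_⟩
  · rw [evenFactor, if_pos h]
  · rw [evenFactor, if_neg (Nat.not_even_iff_odd.2 h), one_mul]

end
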